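/- arXiv:2511.11657 — 4 statements merged into one kernel-verified Lean document; each statement's English description precedes it below -/
import Mathlib

section
/- For every real x ≥ 1, define the sequence c₁ = ⌊x⌋ and c_{i+1} = ⌈c_i·(1 − 1/l_i)⌉ for i ≥ 1. Then there exists an index i ≥ 1 with l_i > c_i, and for every i ≥ 1 with l_i > c_i one has c_i = L(x); in particular the sequence (c_i) is eventually constant and its eventual value is L(x), so L(x) is computed by the finite nested-ceiling expression L(x) = ⌈⋯⌈⌈⌊x⌋(1 − 1/l₁)⌉(1 − 1/l₂)⌉⋯(1 − 1/l_m)⌉ for the first m at which the next lucky number exceeds the current value. -/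
open scoped BigOperators

namespace LuckyPaper

/-- Rank of `k` in `A`: the number of elements of `A` that are `≤ k`
(the 1-indexed position of `k` in `A` when `k ∈ A`). -/
noncomputable def rank (A : Set ℕ) (k : ℕ) : ℕ := Set.ncard {m | m ∈ A ∧ m ≤ k}

/-- One sieve step: delete every `d`-th element of `A` (listed in increasing order). -/
noncomputable def step (A : Set ℕ) (d : ℕ) : Set ℕ := {k | k ∈ A ∧ ¬ d ∣ rank A k}

/-- The lucky sieve: `sieve i = (A_i, l_i)`, where `A_0 = {1,2,3,…}`, `l_0 = 1` (dummy),
`l_{i+1}` is the smallest element of `A_i` larger than `l_i`, and `A_{i+1}` is obtained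
from `A_i` by deleting every `l_{i+1}`-th element.  In particular `l_1 = 2`. -/
noncomputable def sieve : ℕ → Set ℕ × ℕ
  | 0 => ({n | 1 ≤ n}, 1)
  | i + 1 =>
      let p := sieve i
      let d := sInf {m | m ∈ p.1 ∧ p.2 < m}
      (step p.1 d, d)

/-- `A i` : the set of survivors after `i` steps of the lucky sieve. -/
noncomputable def A (i : ℕ) : Set ℕ := (sieve i).1

/-- `l i` : the `i`-th sieve parameter (`l 1 = 2`, `l 2 = 3`, `l 3 = 7`, `l 4 = 9`, …);
with this convention `l n` is the `n`-th lucky number for `n ≥ 2`. -/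
noncomputable def l (i : ℕ) : ℕ := (sieve i).2

/-- The set of lucky numbers `A_∞ = ⋂ i, A i = {1, 3, 7, 9, 13, 15, 21, 25, …}`. -/
noncomputable def LuckySet : Set ℕ := ⋂ i, A i

/-- `L x` : the number of lucky numbers that are `≤ x`. -/
noncomputable def L (x : ℝ) : ℕ := Set.ncard {m | m ∈ LuckySet ∧ (m : ℝ) ≤ x}

/-- `R i x = #{k ∈ A_{i-1} : k ≤ x}`. -/
noncomputable def R (i : ℕ) (x : ℝ) : ℕ := Set.ncard {m | m ∈ A (i - 1) ∧ (m : ℝ) ≤ x}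

/-- `𝕃 = {l 1, l 2, l 3, …} = {2, 3, 7, 9, 13, …}`. -/
noncomputable def Ell : Set ℕ := {a | ∃ i, 1 ≤ i ∧ l i = a}

/-- `starIdx i m` : the `m`-th number deleted at step `i` of the sieve, i.e. the
`(l i * m)`-th smallest element of `A (i-1)` (`Nat.nth` is 0-indexed). -/
noncomputable def starIdx (i m : ℕ) : ℕ := Nat.nth (· ∈ A (i - 1)) (l i * m - 1)

/-- The binary operation `*` : for `a ∈ 𝕃`, `star a m = a * m` is the `m`-th number
deleted at the (unique) step `i ≥ 1` with `l i = a`. -/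
noncomputable def star (a m : ℕ) : ℕ := starIdx (sInf {i | 1 ≤ i ∧ l i = a}) m

/-- `evalStar [a₁, …, a_k] = a₁ * (a₂ * (⋯ * a_k)⋯)`. -/
noncomputable def evalStar : List ℕ → ℕ
  | [] => 1
  | [a] => a
  | a :: b :: rest => star a (evalStar (b :: rest))

/-- `t = (a₁, …, a_k)` is a lucky factorization of `n` : `k ≥ 1`, `a_j ∈ 𝕃` for `j < k`,
`a_k` is a lucky number (possibly 1), and `n = a₁*(a₂*(⋯*a_k)⋯)`. -/
def IsLuckyFactorization (n : ℕ) (t : List ℕ) : Prop :=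
  t ≠ [] ∧ (∀ a ∈ t.dropLast, a ∈ Ell) ∧ t.getLast! ∈ LuckySet ∧ evalStar t = n

/-- The canonical tuple of `n` given by the fundamental theorem of arithmetic
for lucky numbers. -/
noncomputable def canonicalTuple (n : ℕ) : List ℕ :=
  haveI := Classical.propDecidable (∃ t, IsLuckyFactorization n t)
  if h : ∃ t, IsLuckyFactorization n t then h.choose else []

/-- `Ω°(n)` : the length of the canonical tuple of `n`. -/
noncomputable def bigOmega (n : ℕ) : ℕ := (canonicalTuple n).length

/-- `ω°(n)` : the number of distinct entries of the canonical tuple of `n`. -/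
noncomputable def smallOmega (n : ℕ) : ℕ := (canonicalTuple n).dedup.length

/-- `d°(n)` : the number of distinct nonempty contiguous subtuples (infixes) of the
canonical tuple of `n`. -/
noncomputable def dCirc (n : ℕ) : ℕ :=
  Set.ncard {s : List ℕ | s ≠ [] ∧ s <:+: canonicalTuple n}

/-- `B` : positive integers whose canonical tuple has last entry `≠ 1`. -/
noncomputable def Bset : Set ℕ := {n | 1 ≤ n ∧ (canonicalTuple n).getLast! ≠ 1}

/-- `C` : positive integers whose canonical tuple ends with the pair `(2, 1)`. -/
noncomputable def Cset : Set ℕ := {n | 1 ≤ n ∧ ∃ t, canonicalTuple n = t ++ [2, 1]}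

/-- `S = B ∪ C`. -/
noncomputable def Sset : Set ℕ := Bset ∪ Cset

/-- The `𝕃`-tuple of `a ∈ S` : the canonical tuple of `a` if it does not end in `1`,
else the canonical tuple with the final `1` removed (so it ends in `2`). -/
noncomputable def ellTuple (a : ℕ) : List ℕ :=
  if (canonicalTuple a).getLast! = 1 then (canonicalTuple a).dropLast else canonicalTuple a

/-- The extended operation `∘` : if the `𝕃`-tuple of `a` is `(t₁, …, t_k)`, then
`a ∘ b = t₁*(t₂*(⋯*(t_k*b)⋯))`. -/
noncomputable def circ (a b : ℕ) : ℕ := (ellTuple a).foldr star b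


theorem rank_eq_count (S : Set ℕ) [DecidablePred (· ∈ S)] (n : ℕ) :
    rank S n = Nat.count (· ∈ S) (n + 1) := by
  rw [rank, Nat.count_eq_card_filter_range, ← Set.ncard_coe_finset]
  congr 1
  ext m
  simp [and_comm]

theorem mem_step {S : Set ℕ} {d k : ℕ} : k ∈ step S d ↔ k ∈ S ∧ ¬ d ∣ rank S k := Iff.rfl

open Classical in
theorem count_step (S : Set ℕ) (d n : ℕ) :
    Nat.count (· ∈ step S d) n = Nat.count (· ∈ S) n - Nat.count (· ∈ S) n / d := by
  induction n with
  | zero => simp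
  | succ n ih =>
    have hle := Nat.div_le_self (Nat.count (· ∈ S) n) d
    rw [Nat.count_succ, ih, mem_step, rank_eq_count, Nat.count_succ]
    by_cases hn : n ∈ S
    · by_cases hd : d ∣ Nat.count (· ∈ S) n + 1
      · simp only [hn, hd, if_true, Nat.succ_div, not_true, and_false, if_false]
        omega
      · simp only [hn, hd, if_true, Nat.succ_div, not_false_iff, and_true, if_false]
        omega
    · simp [hn]

theorem rank_step (S : Set ℕ) (d n : ℕ) : rank (step S d) n = rank S n - rank S n / d := by
  classical
  simp only [rank_eq_count, count_step]

theorem infinite_step {S : Set ℕ} (hS : S.Infinite) {d : ℕ} (hd : 2 ≤ d) :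
    (step S d).Infinite := by
  classical
  intro hfin
  set B := hfin.toFinset.card
  have hle : ∀ n, Nat.count (· ∈ step S d) n ≤ B := fun n => by
    rw [Nat.count_eq_card_filter_range]
    exact Finset.card_le_card fun m hm => by simpa using (Finset.mem_filter.mp hm).2
  have hcount := hle (Nat.nth (· ∈ S) (2 * B + 2))
  rw [count_step, Nat.count_nth_of_infinite (p := (· ∈ S)) hS] at hcount
  have := Nat.div_le_div_left hd two_pos (a := 2 * B + 2)
  omega

theorem A_succ (i : ℕ) : A (i + 1) = step (A i) (l (i + 1)) := rfl

theorem l_succ (i : ℕ) : l (i + 1) = sInf {m | m ∈ A i ∧ l i < m} := rfl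

theorem l_lt_succ_of_infinite {i : ℕ} (h : (A i).Infinite) : l i < l (i + 1) := by
  obtain ⟨m, hm, hlt⟩ := h.exists_gt (l i)
  rw [l_succ]
  exact (Nat.sInf_mem (s := {m | m ∈ A i ∧ l i < m}) ⟨m, hm, hlt⟩).2

theorem infinite_A_and_one_le_l (i : ℕ) : (A i).Infinite ∧ 1 ≤ l i := by
  induction i with
  | zero => exact ⟨Set.Ici_infinite 1, le_rfl⟩
  | succ i ih =>
    have hlt := l_lt_succ_of_infinite ih.1
    exact ⟨A_succ i ▸ infinite_step ih.1 (by omega), by omega⟩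

theorem strictMono_l : StrictMono l :=
  strictMono_nat_of_lt_succ fun i => l_lt_succ_of_infinite (infinite_A_and_one_le_l i).1

theorem antitone_A : Antitone A :=
  antitone_nat_of_succ_le fun _ _ hk => hk.1

theorem rank_A_zero (n : ℕ) : rank (A 0) n = n := by
  have : {m | m ∈ A 0 ∧ m ≤ n} = (Finset.Icc 1 n : Set ℕ) := by
    ext m
    simp [A, sieve]
  rw [rank, this, Set.ncard_coe_finset, Nat.card_Icc, Nat.add_sub_cancel]

theorem rank_A_succ (i n : ℕ) :
    rank (A (i + 1)) n = rank (A i) n - rank (A i) n / l (i + 1) :=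
  rank_step _ _ _

theorem rank_A_eq_of_lt {i n : ℕ} (h : rank (A i) n < l (i + 1)) {j : ℕ} (hij : i ≤ j) :
    rank (A j) n = rank (A i) n := by
  induction j, hij using Nat.le_induction with
  | base => rfl
  | succ j hij ih =>
    have hl : l (i + 1) ≤ l (j + 1) := strictMono_l.monotone (by omega)
    rw [rank_A_succ, ih, Nat.div_eq_of_lt (h.trans_le hl), Nat.sub_zero]

theorem rank_luckySet_of_lt {i n : ℕ} (h : rank (A i) n < l (i + 1)) :
    rank LuckySet n = rank (A i) n := by
  unfold rank
  congr 1
  ext m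
  refine ⟨fun hm => ⟨Set.mem_iInter.mp hm.1 i, hm.2⟩, fun hm => ⟨Set.mem_iInter.mpr fun j => ?_, hm.2⟩⟩
  rcases le_total j i with hji | hij
  · exact antitone_A hji hm.1
  · have heq : {m | m ∈ A j ∧ m ≤ n} = {m | m ∈ A i ∧ m ≤ n} :=
      Set.eq_of_subset_of_ncard_le (fun k hk => ⟨antitone_A hij hk.1, hk.2⟩)
        (rank_A_eq_of_lt h hij).ge ((Set.finite_Iic n).subset fun k hk => hk.2)
    exact (heq.ge hm).1

theorem L_eq_rank {x : ℝ} (hx : 0 ≤ x) : L x = rank LuckySet ⌊x⌋₊ := by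
  simp only [L, rank, Nat.le_floor_iff hx]

theorem ceil_mul_one_sub_inv (a d : ℕ) :
    ⌈(a : ℝ) * (1 - 1 / (d : ℝ))⌉ = ((a - a / d : ℕ) : ℤ) := by
  have hfloor : ⌊(a : ℝ) / d⌋ = ((a / d : ℕ) : ℤ) := by
    rw [← Nat.floor_div_eq_div (K := ℝ) a d, Int.natCast_floor_eq_floor (by positivity)]
  have hrw : (a : ℝ) * (1 - 1 / (d : ℝ)) = -((a : ℝ) / d) + (a : ℕ) := by ring
  rw [hrw, Int.ceil_add_natCast, Int.ceil_neg, hfloor, Nat.cast_sub (Nat.div_le_self a d)]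
  ring

/-- for every real `x ≥ 1`, the sequence `c₁ = ⌊x⌋`,
`c_{i+1} = ⌈c_i·(1 − 1/l_i)⌉` eventually satisfies `l_i > c_i`, and whenever `l_i > c_i`
(for `i ≥ 1`) one has `c_i = L(x)`; so `L(x)` is computed by the finite nested-ceiling
expression. -/
theorem count_eq_nested_ceiling (x : ℝ) (hx : 1 ≤ x) (c : ℕ → ℕ)
    (hc1 : (c 1 : ℤ) = ⌊x⌋)
    (hrec : ∀ i, 1 ≤ i → (c (i + 1) : ℤ) = ⌈(c i : ℝ) * (1 - 1 / (l i : ℝ))⌉) :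
    (∃ i, 1 ≤ i ∧ c i < l i) ∧ (∀ i, 1 ≤ i → c i < l i → c i = L x) := by
  have hx0 : 0 ≤ x := zero_le_one.trans hx
  have hc : ∀ i, c (i + 1) = rank (A i) ⌊x⌋₊ := fun i => by
    induction i with
    | zero =>
      rw [rank_A_zero]
      exact_mod_cast hc1.trans (Int.natCast_floor_eq_floor hx0).symm
    | succ i ih =>
      rw [rank_A_succ, ← ih]
      exact_mod_cast (hrec (i + 1) (by omega)).trans (ceil_mul_one_sub_inv _ _)
  refine ⟨⟨⌊x⌋₊ + 1, by omega, ?_⟩, fun i hi hlt => ?_⟩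
  · have hle : rank (A ⌊x⌋₊) ⌊x⌋₊ ≤ rank (A 0) ⌊x⌋₊ :=
      Set.ncard_le_ncard (fun k hk => ⟨antitone_A (Nat.zero_le _) hk.1, hk.2⟩)
        ((Set.finite_Iic ⌊x⌋₊).subset fun k hk => hk.2)
    rw [rank_A_zero] at hle
    have := strictMono_l.id_le (⌊x⌋₊ + 1)
    rw [hc]
    simp only [id] at this
    omega
  · obtain ⟨i, rfl⟩ := Nat.exists_eq_add_of_le' hi
    rw [hc] at hlt
    rw [hc, L_eq_rank hx0, rank_luckySet_of_lt hlt]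

end LuckyPaper
end

section
/- For every integer n ≥ 1, n ≥ 2^{Ω°(n) − 1}; equivalently, Ω°(n) ≤ log₂(n) + 1. -/
open scoped BigOperators

namespace LuckyPaper

/-- The `k`-th (0-indexed) element of an infinite set `B` has rank `k + 1` in `B`. -/
theorem rank_nth {B : Set ℕ} (hB : B.Infinite) (k : ℕ) :
    rank B (Nat.nth (· ∈ B) k) = k + 1 := by
  classical
  have hcount := Nat.count_nth_succ_of_infinite (p := (· ∈ B)) hB k
  rw [Nat.count_eq_card_filter_range] at hcount
  rw [rank, ← hcount, ← Set.ncard_coe_finset]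
  congr 1
  ext m
  simp [and_comm]

/-- Deleting every `d`-th element of an infinite set leaves an infinite set when `2 ≤ d`. -/
theorem infinite_step_s7 {B : Set ℕ} (hB : B.Infinite) {d : ℕ} (hd : 2 ≤ d) :
    (step B d).Infinite := by
  refine Set.infinite_of_injective_forall_mem (f := fun k => Nat.nth (· ∈ B) (d * k)) ?_ ?_
  · intro j k hjk
    exact Nat.eq_of_mul_eq_mul_left (by omega) (Nat.nth_injective hB hjk)
  · intro k
    refine ⟨Nat.nth_mem_of_infinite hB _, ?_⟩
    rw [rank_nth hB, Nat.dvd_add_right (dvd_mul_right d k), Nat.dvd_one]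
    omega

theorem l_succ_mem {i : ℕ} (hA : (A i).Infinite) : l (i + 1) ∈ A i ∧ l i < l (i + 1) := by
  obtain ⟨m, hm, hlt⟩ := hA.exists_gt (l i)
  exact Nat.sInf_mem (s := {m | m ∈ A i ∧ l i < m}) ⟨m, hm, hlt⟩

theorem infinite_A_and_lt_l (i : ℕ) : (A i).Infinite ∧ i < l i := by
  induction i with
  | zero =>
    exact ⟨Set.infinite_of_forall_exists_gt fun a => ⟨a + 1, Nat.le_add_left 1 a, by simp⟩,
      Nat.one_pos⟩
  | succ i ih =>
    have hlt : i + 1 < l (i + 1) := lt_of_le_of_lt ih.2 (l_succ_mem ih.1).2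
    exact ⟨infinite_step_s7 ih.1 (d := l (i + 1)) (by omega), hlt⟩

theorem one_le_of_mem_A {i m : ℕ} (hm : m ∈ A i) : 1 ≤ m := by
  induction i with
  | zero => exact hm
  | succ i ih => exact ih hm.1

theorem l_mul_le_starIdx (i m : ℕ) : l i * m ≤ starIdx i m := by
  have hA := (infinite_A_and_lt_l (i - 1)).1
  have hmono := Nat.nth_strictMono (p := (· ∈ A (i - 1))) hA
  have hpos := one_le_of_mem_A (Nat.nth_mem_of_infinite (p := (· ∈ A (i - 1))) hA 0)
  have hle := hmono.add_le_nat (l i * m - 1) 0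
  simp only [starIdx, add_zero] at hle ⊢
  omega

theorem two_mul_le_star {a : ℕ} (ha : a ∈ Ell) (m : ℕ) : 2 * m ≤ star a m := by
  have hi : 1 ≤ sInf {i | 1 ≤ i ∧ l i = a} := (Nat.sInf_mem ha).1
  have hl := (infinite_A_and_lt_l (sInf {i | 1 ≤ i ∧ l i = a})).2
  exact (Nat.mul_le_mul_right m (by omega)).trans (l_mul_le_starIdx _ m)

theorem two_pow_le_evalStar {t : List ℕ} (hne : t ≠ []) (hmem : ∀ a ∈ t.dropLast, a ∈ Ell)
    (hlast : t.getLast! ∈ LuckySet) : 2 ^ (t.length - 1) ≤ evalStar t := by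
  induction t with
  | nil => exact absurd rfl hne
  | cons a s ih =>
    cases s with
    | nil => exact one_le_of_mem_A (Set.mem_iInter.1 hlast 0)
    | cons b r =>
      have hrec := ih (by simp) (fun c hc => hmem c (by simp [hc]))
        (by simpa [List.getLast!] using hlast)
      calc 2 ^ ((a :: b :: r).length - 1) = 2 * 2 ^ ((b :: r).length - 1) := by
            simp [pow_succ']
        _ ≤ 2 * evalStar (b :: r) := Nat.mul_le_mul_left 2 hrec
        _ ≤ evalStar (a :: b :: r) := two_mul_le_star (hmem a (by simp)) _

theorem two_pow_bigOmega_sub_one_le {n : ℕ} (hn : 1 ≤ n) : 2 ^ (bigOmega n - 1) ≤ n := by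
  unfold bigOmega canonicalTuple
  split_ifs with h
  · obtain ⟨hne, hmem, hlast, heval⟩ := h.choose_spec
    exact (two_pow_le_evalStar hne hmem hlast).trans_eq heval
  · simpa using hn

/-- for every integer `n ≥ 1`, `n ≥ 2^{Ω°(n) − 1}`; equivalently
`Ω°(n) ≤ log₂(n) + 1`. -/
theorem bigOmega_le (n : ℕ) (hn : 1 ≤ n) :
    2 ^ (bigOmega n - 1) ≤ n ∧ (bigOmega n : ℝ) ≤ Real.logb 2 (n : ℝ) + 1 := by
  have hpow := two_pow_bigOmega_sub_one_le hn
  refine ⟨hpow, ?_⟩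
  have hlog : ((bigOmega n - 1 : ℕ) : ℝ) ≤ Real.logb 2 n := by
    rw [Real.le_logb_iff_rpow_le one_lt_two (by exact_mod_cast hn), Real.rpow_natCast]
    exact_mod_cast hpow
  have hsub : (bigOmega n : ℝ) ≤ ((bigOmega n - 1 : ℕ) : ℝ) + 1 := by
    exact_mod_cast (by omega : bigOmega n ≤ bigOmega n - 1 + 1)
  linarith

end LuckyPaper
end

section
/- For every integer n ≥ 1, (ω°(n)² + ω°(n))/2 ≤ d°(n) ≤ (Ω°(n)² − Ω°(n))/2 + ω°(n), and both inequalities are equalities whenever ω°(n) = Ω°(n) (i.e., whenever all entries of the canonical tuple of n are distinct). -/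
open scoped BigOperators

namespace LuckyPaper

/-- The set of nonempty contiguous subtuples of a list. -/
def nonemptyInfixes {α : Type*} (t : List α) : Set (List α) := {s | s ≠ [] ∧ s <:+: t}

/-- The set of nonempty initial segments of a list. -/
def nonemptyPrefixes {α : Type*} (t : List α) : Set (List α) := {s | s ≠ [] ∧ s <+: t}

lemma finite_nonemptyInfixes {α : Type*} (t : List α) : (nonemptyInfixes t).Finite :=
  (List.finite_toSet t.sublists).subset fun _ hs => List.mem_sublists.2 hs.2.sublist

lemma nonemptyPrefixes_subset {α : Type*} (t : List α) :
    nonemptyPrefixes t ⊆ nonemptyInfixes t :=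
  fun _ hs => ⟨hs.1, hs.2.isInfix⟩

lemma finite_nonemptyPrefixes {α : Type*} (t : List α) : (nonemptyPrefixes t).Finite :=
  (finite_nonemptyInfixes t).subset (nonemptyPrefixes_subset t)

lemma nonemptyPrefixes_eq_image {α : Type*} (t : List α) :
    nonemptyPrefixes t = (fun i => t.take i) '' Set.Icc 1 t.length := by
  ext s
  constructor
  · rintro ⟨hs, hp⟩
    exact ⟨s.length, ⟨List.length_pos_iff.2 hs, hp.length_le⟩,
      (List.prefix_iff_eq_take.1 hp).symm⟩
  · rintro ⟨i, ⟨hi, hit⟩, rfl⟩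
    refine ⟨List.ne_nil_of_length_pos ?_, List.take_prefix i t⟩
    simp only [List.length_take]
    omega

lemma ncard_nonemptyPrefixes {α : Type*} (t : List α) :
    (nonemptyPrefixes t).ncard = t.length := by
  rw [nonemptyPrefixes_eq_image, Set.InjOn.ncard_image]
  · rw [← Finset.coe_Icc, Set.ncard_coe_finset, Nat.card_Icc, Nat.add_sub_cancel]
  · intro i hi j hj hij
    have h := congrArg List.length hij
    simp only [List.length_take] at h
    have := hi.2
    have := hj.2
    omega

lemma nonemptyInfixes_cons {α : Type*} (a : α) (t : List α) :
    nonemptyInfixes (a :: t) = nonemptyPrefixes (a :: t) ∪ nonemptyInfixes t := by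
  ext s
  simp only [nonemptyInfixes, nonemptyPrefixes, Set.mem_union, Set.mem_ofPred_eq,
    List.infix_cons_iff, and_or_left]

/-- If the head `a` is new, every nonempty prefix of `a :: t` is a new infix. -/
lemma ncard_nonemptyInfixes_cons_of_notMem {α : Type*} {a : α} {t : List α} (h : a ∉ t) :
    (nonemptyInfixes (a :: t)).ncard = t.length + 1 + (nonemptyInfixes t).ncard := by
  rw [nonemptyInfixes_cons, Set.ncard_union_eq _ (finite_nonemptyPrefixes _)
    (finite_nonemptyInfixes _), ncard_nonemptyPrefixes, List.length_cons]
  refine Set.disjoint_left.2 fun s hs hi => h ?_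
  obtain ⟨b, s, rfl⟩ := List.exists_cons_of_ne_nil hs.1
  obtain rfl := (List.cons_prefix_cons.1 hs.2).1
  exact hi.2.subset List.mem_cons_self

/-- If the head `a` is not new, then `[a]` is not a new infix of `a :: t`. -/
lemma ncard_nonemptyInfixes_cons_le_of_mem {α : Type*} {a : α} {t : List α} (h : a ∈ t) :
    (nonemptyInfixes (a :: t)).ncard ≤ t.length + (nonemptyInfixes t).ncard := by
  have hp : [a] ∈ nonemptyPrefixes (a :: t) := ⟨by simp, by simp⟩
  have hi : [a] ∈ nonemptyInfixes t :=
    ⟨by simp, (List.singleton_infix_iff a t).2 h⟩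
  have hsub : nonemptyInfixes (a :: t) ⊆
      nonemptyPrefixes (a :: t) \ {[a]} ∪ nonemptyInfixes t := by
    rw [nonemptyInfixes_cons]
    rintro s (hs | hs)
    · by_cases hsa : s = [a]
      · exact Or.inr (hsa ▸ hi)
      · exact Or.inl ⟨hs, hsa⟩
    · exact Or.inr hs
  refine (Set.ncard_le_ncard hsub ((finite_nonemptyPrefixes _).sdiff.union
    (finite_nonemptyInfixes _))).trans ((Set.ncard_union_le _ _).trans ?_)
  rw [Set.ncard_sdiff_singleton_of_mem hp, ncard_nonemptyPrefixes, List.length_cons,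
    Nat.add_sub_cancel]

lemma dedup_length_le_ncard_nonemptyInfixes {α : Type*} [DecidableEq α] (t : List α) :
    t.dedup.length ^ 2 + t.dedup.length ≤ 2 * (nonemptyInfixes t).ncard := by
  induction t with
  | nil => simp
  | cons a t ih =>
    by_cases h : a ∈ t
    · rw [List.dedup_cons_of_mem h]
      refine ih.trans (Nat.mul_le_mul_left 2 (Set.ncard_le_ncard ?_ (finite_nonemptyInfixes _)))
      rw [nonemptyInfixes_cons]
      exact Set.subset_union_right
    · rw [List.dedup_cons_of_notMem h, ncard_nonemptyInfixes_cons_of_notMem h, List.length_cons]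
      have := (List.dedup_sublist t).length_le
      linarith

lemma ncard_nonemptyInfixes_le {α : Type*} [DecidableEq α] (t : List α) :
    2 * (nonemptyInfixes t).ncard + t.length ≤ t.length ^ 2 + 2 * t.dedup.length := by
  induction t with
  | nil => simp [nonemptyInfixes]
  | cons a t ih =>
    by_cases h : a ∈ t
    · have := ncard_nonemptyInfixes_cons_le_of_mem h
      rw [List.dedup_cons_of_mem h, List.length_cons]
      linarith
    · rw [List.dedup_cons_of_notMem h, ncard_nonemptyInfixes_cons_of_notMem h, List.length_cons,
        List.length_cons]
      linarith

/-- for every integer `n ≥ 1`,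
`(ω°(n)² + ω°(n))/2 ≤ d°(n) ≤ (Ω°(n)² − Ω°(n))/2 + ω°(n)`, with equality in both
inequalities whenever `ω°(n) = Ω°(n)`. -/
theorem dCirc_bounds (n : ℕ) (hn : 1 ≤ n) :
    (((smallOmega n : ℝ) ^ 2 + (smallOmega n : ℝ)) / 2 ≤ (dCirc n : ℝ) ∧
      (dCirc n : ℝ) ≤ ((bigOmega n : ℝ) ^ 2 - (bigOmega n : ℝ)) / 2 + (smallOmega n : ℝ)) ∧
    (smallOmega n = bigOmega n →
      ((smallOmega n : ℝ) ^ 2 + (smallOmega n : ℝ)) / 2 = (dCirc n : ℝ) ∧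
        (dCirc n : ℝ) = ((bigOmega n : ℝ) ^ 2 - (bigOmega n : ℝ)) / 2 + (smallOmega n : ℝ)) := by
  have hlower : (smallOmega n : ℝ) ^ 2 + smallOmega n ≤ 2 * dCirc n := by
    exact_mod_cast dedup_length_le_ncard_nonemptyInfixes (canonicalTuple n)
  have hupper : 2 * (dCirc n : ℝ) + bigOmega n ≤ (bigOmega n : ℝ) ^ 2 + 2 * smallOmega n := by
    exact_mod_cast ncard_nonemptyInfixes_le (canonicalTuple n)
  refine ⟨⟨by linarith, by linarith⟩, fun h => ?_⟩
  rw [← h] at hupper ⊢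
  constructor <;> linarith

end LuckyPaper
end

section
/- There exists a constant C > 0 with the following property: for every strictly increasing sequence (k_i)_{i≥1} of positive integers, the real sequence defined by s₁ = 2 and s_i = 2 + s_{i−1} + (s_{i−1} + 1)/(2(k_i − 1) + 1) for i ≥ 2 satisfies s_{n+1} ≤ C·n for all n ≥ 1. -/
/-- there exists a constant `C > 0` such that for every strictly increasing
sequence `(k_i)` of positive integers, the real sequence `s₁ = 2`,
`s_i = 2 + s_{i−1} + (s_{i−1} + 1)/(2(k_i − 1) + 1)` for `i ≥ 2` satisfies
`s_{n+1} ≤ C·n` for all `n ≥ 1`. -/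
theorem recurrence_linear_bound :
    ∃ C : ℝ, 0 < C ∧ ∀ k : ℕ → ℕ, StrictMono k → (∀ i, 1 ≤ k i) →
      ∀ s : ℕ → ℝ, s 1 = 2 →
        (∀ i, 2 ≤ i → s i = 2 + s (i - 1) + (s (i - 1) + 1) / (2 * ((k i : ℝ) - 1) + 1)) →
        ∀ n : ℕ, 1 ≤ n → s (n + 1) ≤ C * (n : ℝ) := by
  refine ⟨7, by norm_num, fun k hk _ s h1 hs => ?_⟩
  have key : ∀ m : ℕ, 0 ≤ s (m + 1) + 1 ∧ s (m + 1) + 1 ≤ 4 * ((m : ℝ) + 1) := by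
    intro m
    induction m with
    | zero => norm_num [h1]
    | succ m ih =>
      obtain ⟨hnonneg, hle⟩ := ih
      have hrec := hs (m + 1 + 1) (by omega)
      rw [Nat.add_sub_cancel] at hrec
      have hk' : (m : ℝ) + 2 ≤ k (m + 1 + 1) := by exact_mod_cast hk.id_le (m + 1 + 1)
      have hm : (0 : ℝ) ≤ m := m.cast_nonneg
      have hd : 0 < 2 * ((k (m + 1 + 1) : ℝ) - 1) + 1 := by linarith
      have hq_nonneg := div_nonneg hnonneg hd.le
      have hq_le : (s (m + 1) + 1) / (2 * ((k (m + 1 + 1) : ℝ) - 1) + 1) ≤ 2 := by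
        rw [div_le_iff₀ hd]
        linarith
      push_cast
      constructor <;> linarith
  intro n hn
  have hn' : (1 : ℝ) ≤ n := by exact_mod_cast hn
  linarith [(key n).2]
end
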